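/- arXiv:2501.16041 — 6 statements merged into one kernel-verified Lean document; each statement's English description precedes it below -/
import Mathlib

section
/- Let (μ_n)_{n≥1} be a sequence of positive real numbers. Suppose that for every real sequence (z_n)_{n≥1} such that ∑_{n=1}^∞ |z_n| converges and ∑_{n=1}^∞ μ_n z_n² converges, the inequality (∑_{n=1}^∞ z_n)² ≤ ∑_{n=1}^∞ μ_n z_n² holds. Then for every finite set F ⊆ ℕ one has ∑_{n∈F} 1/μ_n ≤ 1; consequently the series ∑_{n=1}^∞ 1/μ_n converges with sum at most 1. -/
/-- Necessity direction of the harmonic inequality: if `(∑ z n)² ≤ ∑ μ n * (z n)²`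
holds for all absolutely summable `z` with `∑ μ n * (z n)²` convergent, then
every finite partial sum of `1/μ n` is at most `1`; consequently `∑ 1/μ n`
converges with sum at most `1`. -/
theorem harmonic_inequality_necessity
    (μ : ℕ → ℝ) (hμpos : ∀ n, 0 < μ n)
    (H : ∀ z : ℕ → ℝ, (Summable fun n => |z n|) →
      (Summable fun n => μ n * (z n) ^ 2) →
      (∑' n, z n) ^ 2 ≤ ∑' n, μ n * (z n) ^ 2) :
    (∀ F : Finset ℕ, (∑ n ∈ F, (μ n)⁻¹) ≤ 1) ∧
      (Summable fun n => (μ n)⁻¹) ∧ (∑' n, (μ n)⁻¹) ≤ 1 := by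
  have hfin : ∀ F : Finset ℕ, (∑ n ∈ F, (μ n)⁻¹) ≤ 1 := by
    intro F
    let z : ℕ → ℝ := fun n => if n ∈ F then (μ n)⁻¹ else 0
    have hz : ∀ n ∉ F, z n = 0 := fun n hn => if_neg hn
    have hzF : ∀ n ∈ F, z n = (μ n)⁻¹ := fun n hn => if_pos hn
    have hq : ∀ n ∉ F, μ n * (z n) ^ 2 = 0 := fun n hn => by simp [hz n hn]
    have key := H z (summable_of_ne_finset_zero (s := F) fun n hn => by simp [hz n hn])
      (summable_of_ne_finset_zero (s := F) hq)
    rw [tsum_eq_sum hz, tsum_eq_sum hq, Finset.sum_congr rfl hzF] at key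
    have hsum : ∑ n ∈ F, μ n * (z n) ^ 2 = ∑ n ∈ F, (μ n)⁻¹ :=
      Finset.sum_congr rfl fun n hn => by
        have := (hμpos n).ne'
        rw [hzF n hn]
        field_simp
    rw [hsum] at key
    nlinarith
  have hnonneg : ∀ n, 0 ≤ (μ n)⁻¹ := fun n => (inv_pos.mpr (hμpos n)).le
  exact ⟨hfin, summable_of_sum_le hnonneg hfin, Real.tsum_le_of_sum_le hnonneg hfin⟩
end

section
/- Let M be a positive natural number and let μ : Fin M → ℝ with μ_i > 0 for all i. Then the inequality (∑_{i} z_i)² ≤ ∑_{i} μ_i z_i² holds for every vector z ∈ ℝ^M if and only if ∑_{i} μ_i^{-1} ≤ 1. -/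
/-- Finite-dimensional harmonic inequality: for positive `μ : Fin M → ℝ`,
`(∑ i, z i)² ≤ ∑ i, μ i * (z i)²` holds for all `z : Fin M → ℝ` iff
`∑ i, (μ i)⁻¹ ≤ 1`. -/
theorem harmonic_inequality_fin (M : ℕ) (hM : 0 < M)
    (μ : Fin M → ℝ) (hμpos : ∀ i, 0 < μ i) :
    (∀ z : Fin M → ℝ, (∑ i, z i) ^ 2 ≤ ∑ i, μ i * (z i) ^ 2) ↔
      (∑ i, (μ i)⁻¹) ≤ 1 := by
  constructor
  · intro h
    have hsq := h fun i ↦ (μ i)⁻¹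
    have hsum : ∑ i, μ i * (μ i)⁻¹ ^ 2 = ∑ i, (μ i)⁻¹ := by
      refine Finset.sum_congr rfl fun i _ ↦ ?_
      have := (hμpos i).ne'
      field_simp
    rw [hsum] at hsq
    by_contra! hlt
    nlinarith
  · intro h z
    have hnonneg : ∀ i ∈ Finset.univ, 0 ≤ μ i * z i ^ 2 := fun i _ ↦
      mul_nonneg (hμpos i).le (sq_nonneg _)
    calc (∑ i, z i) ^ 2 ≤ (∑ i, (μ i)⁻¹) * ∑ i, μ i * z i ^ 2 :=
          Finset.sum_sq_le_sum_mul_sum_of_sq_le_mul _ (fun i _ ↦ (inv_pos.2 (hμpos i)).le)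
            hnonneg fun i _ ↦ (inv_mul_cancel_left₀ (hμpos i).ne' _).ge
      _ ≤ ∑ i, μ i * z i ^ 2 := mul_le_of_le_one_left (Finset.sum_nonneg hnonneg) h
end

section
/- Let c ≥ 0 be a real number and N ≥ 1 a natural number with c < N². Then (2/π) ∑_{n=N}^∞ 1/(n² − c) ≤ (2N + 1/π)/(N² − c). -/
open Real

/-- A telescoping bound for the terms of the shifted resolvent sum. -/
lemma one_div_sq_sub_le_telescoping {c a x : ℝ} (hc : 0 ≤ c) (hca : c < a ^ 2) (ha : 0 < a)
    (hax : a ≤ x) (hx : 1 ≤ x) :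
    1 / (x ^ 2 - c) ≤ 2 * a ^ 2 / (a ^ 2 - c) * (1 / x - 1 / (x + 1)) := by
  have hx0 : 0 < x := by linarith
  have hsq : a ^ 2 ≤ x ^ 2 := by gcongr
  have hD : 0 < a ^ 2 - c := by linarith
  have hE : 0 < x ^ 2 - c := by linarith
  calc 1 / (x ^ 2 - c) ≤ a ^ 2 / (a ^ 2 - c) * (1 / x ^ 2) := by
        rw [div_mul_div_comm, div_le_div_iff₀ hE (by positivity)]
        nlinarith [mul_le_mul_of_nonneg_left hsq hc]
    _ ≤ a ^ 2 / (a ^ 2 - c) * (2 * (1 / x - 1 / (x + 1))) := by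
        gcongr
        rw [div_sub_div _ _ hx0.ne' (by positivity), mul_div_assoc',
          div_le_div_iff₀ (by positivity) (by positivity)]
        nlinarith [mul_nonneg hx0.le (sub_nonneg.2 hx)]
    _ = 2 * a ^ 2 / (a ^ 2 - c) * (1 / x - 1 / (x + 1)) := by ring

lemma tsum_one_div_sq_sub_le {c : ℝ} (hc : 0 ≤ c) {N : ℕ} (hN : 1 ≤ N)
    (hcN : c < (N : ℝ) ^ 2) :
    ∑' n : ℕ, 1 / (((n + N : ℕ) : ℝ) ^ 2 - c) ≤ 2 * N / ((N : ℝ) ^ 2 - c) := by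
  have hN1 : (1 : ℝ) ≤ N := by exact_mod_cast hN
  have hN0 : (0 : ℝ) < N := by linarith
  have hD : 0 < (N : ℝ) ^ 2 - c := by linarith
  have hle (n : ℕ) : (N : ℝ) ≤ (n + N : ℕ) := by exact_mod_cast Nat.le_add_left N n
  refine Real.tsum_le_of_sum_range_le (fun n => ?_) (fun m => ?_)
  · have : (N : ℝ) ^ 2 ≤ ((n + N : ℕ) : ℝ) ^ 2 := by gcongr; exact Nat.le_add_left N n
    exact one_div_nonneg.2 (by linarith)
  · calc ∑ n ∈ Finset.range m, 1 / (((n + N : ℕ) : ℝ) ^ 2 - c)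
        ≤ ∑ n ∈ Finset.range m, 2 * (N : ℝ) ^ 2 / ((N : ℝ) ^ 2 - c) *
            (1 / ((n + N : ℕ) : ℝ) - 1 / ((n + 1 + N : ℕ) : ℝ)) := by
          refine Finset.sum_le_sum fun n _ => ?_
          have h := one_div_sq_sub_le_telescoping hc hcN hN0 (hle n) (hN1.trans (hle n))
          rwa [show ((n + 1 + N : ℕ) : ℝ) = ((n + N : ℕ) : ℝ) + 1 by push_cast; ring]
      _ = 2 * (N : ℝ) ^ 2 / ((N : ℝ) ^ 2 - c) *
            (1 / ((0 + N : ℕ) : ℝ) - 1 / ((m + N : ℕ) : ℝ)) := by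
          rw [← Finset.mul_sum, Finset.sum_range_sub' (fun n : ℕ => 1 / ((n + N : ℕ) : ℝ))]
      _ ≤ 2 * (N : ℝ) ^ 2 / ((N : ℝ) ^ 2 - c) * (1 / (N : ℝ)) := by
          rw [zero_add]
          gcongr
          exact sub_le_self _ (by positivity)
      _ = 2 * N / ((N : ℝ) ^ 2 - c) := by
          field_simp

/-- The harmonic-inequality residue gain is no larger than the Sobolev-based
one: for `0 ≤ c < N²` with `N ≥ 1`,
`(2/π) ∑_{n=N}^∞ 1/(n² − c) ≤ (2N + 1/π)/(N² − c)`. -/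
theorem harmonic_gain_le_sobolev_gain
    (c : ℝ) (hc : 0 ≤ c) (N : ℕ) (hN : 1 ≤ N) (hcN : c < (N : ℝ) ^ 2) :
    (2 / π) * (∑' n : ℕ, 1 / (((n + N : ℕ) : ℝ) ^ 2 - c)) ≤
      (2 * N + 1 / π) / ((N : ℝ) ^ 2 - c) := by
  have hD : 0 < (N : ℝ) ^ 2 - c := by linarith
  have hpi : 2 / π ≤ 1 := (div_le_one pi_pos).2 two_le_pi
  calc (2 / π) * (∑' n : ℕ, 1 / (((n + N : ℕ) : ℝ) ^ 2 - c))
      ≤ (2 / π) * (2 * N / ((N : ℝ) ^ 2 - c)) := by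
        gcongr
        exact tsum_one_div_sq_sub_le hc hN hcN
    _ ≤ 2 * N / ((N : ℝ) ^ 2 - c) := mul_le_of_le_one_left (by positivity) hpi
    _ ≤ (2 * N + 1 / π) / ((N : ℝ) ^ 2 - c) := by
        gcongr
        exact le_add_of_nonneg_right (by positivity)
end

section
/- Let γ > 0 and σ > 0 be reals, let A, X, Z be real N×N matrices with X and Z symmetric and Z invertible, let B ∈ ℝ^N be a column vector and C ∈ ℝ^{1×N} a row vector. Suppose X A + Aᵀ X − X (B Bᵀ − γσ I) X + (σ/γ) I = 0 and Z Aᵀ + A Z − Z (Cᵀ C − γσ I) Z + (σ/γ) I = 0. Define Y = γ^{-2} Z^{-1} − X. Then Y (A + γσ X) + (A + γσ X)ᵀ Y + X B Bᵀ X + γσ Y² − γ^{-2} Cᵀ C = 0. -/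
open Matrix

/-- Key matrix identity of Theorem 1: if `X` and `Z` are symmetric solutions of
the two algebraic Riccati equations, `Z` is invertible, and
`Y = γ⁻² Z⁻¹ − X`, then
`Y(A + γσX) + (A + γσX)ᵀY + XBBᵀX + γσY² − γ⁻²CᵀC = 0`. -/
theorem riccati_observer_identity {N : ℕ} (γ σ : ℝ) (hγ : 0 < γ) (hσ : 0 < σ)
    (A X Z : Matrix (Fin N) (Fin N) ℝ)
    (hX : X.IsSymm) (hZ : Z.IsSymm) (hZinv : IsUnit Z)
    (B : Matrix (Fin N) (Fin 1) ℝ) (C : Matrix (Fin 1) (Fin N) ℝ)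
    (hARE_X : X * A + Aᵀ * X - X * (B * Bᵀ - (γ * σ) • (1 : Matrix (Fin N) (Fin N) ℝ)) * X
        + (σ / γ) • (1 : Matrix (Fin N) (Fin N) ℝ) = 0)
    (hARE_Z : Z * Aᵀ + A * Z - Z * (Cᵀ * C - (γ * σ) • (1 : Matrix (Fin N) (Fin N) ℝ)) * Z
        + (σ / γ) • (1 : Matrix (Fin N) (Fin N) ℝ) = 0)
    (Y : Matrix (Fin N) (Fin N) ℝ) (hY : Y = (γ ^ 2)⁻¹ • Z⁻¹ - X) :
    Y * (A + (γ * σ) • X) + (A + (γ * σ) • X)ᵀ * Y + X * B * Bᵀ * X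
        + (γ * σ) • (Y * Y) - (γ ^ 2)⁻¹ • (Cᵀ * C) = 0 := by
  have hdet : IsUnit Z.det := (Matrix.isUnit_iff_isUnit_det Z).mp hZinv
  have hWZ : Z⁻¹ * Z = 1 := Matrix.nonsing_inv_mul Z hdet
  have hZW : Z * Z⁻¹ = 1 := Matrix.mul_nonsing_inv Z hdet
  generalize Z⁻¹ = W at hWZ hZW hY
  have hγ0 : γ ≠ 0 := hγ.ne'
  have hW : Aᵀ * W + W * A - (Cᵀ * C - (γ * σ) • (1 : Matrix (Fin N) (Fin N) ℝ))
      + (σ / γ) • (W * W) = 0 := by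
    have key : W * (Z * Aᵀ + A * Z - Z * (Cᵀ * C - (γ * σ) • (1 : Matrix (Fin N) (Fin N) ℝ)) * Z
        + (σ / γ) • (1 : Matrix (Fin N) (Fin N) ℝ)) * W
        = (W * Z) * Aᵀ * W + W * A * (Z * W)
          - (W * Z) * (Cᵀ * C - (γ * σ) • (1 : Matrix (Fin N) (Fin N) ℝ)) * (Z * W)
          + (σ / γ) • (W * W) := by
      rw [mul_add, add_mul, mul_smul_comm, smul_mul_assoc, mul_one]
      noncomm_ring
    rw [hARE_Z, hWZ, hZW] at key
    simpa using key.symm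
  have hcomb : (γ ^ 2)⁻¹ • (Aᵀ * W + W * A
        - (Cᵀ * C - (γ * σ) • (1 : Matrix (Fin N) (Fin N) ℝ)) + (σ / γ) • (W * W))
      - (X * A + Aᵀ * X - X * (B * Bᵀ - (γ * σ) • (1 : Matrix (Fin N) (Fin N) ℝ)) * X
        + (σ / γ) • (1 : Matrix (Fin N) (Fin N) ℝ)) = 0 := by
    rw [hW, hARE_X, smul_zero, sub_zero]
  rw [← hcomb, hY, Matrix.mul_assoc X B Bᵀ, transpose_add, transpose_smul, hX.eq]
  simp only [mul_add, add_mul, mul_sub, sub_mul, mul_smul_comm, smul_mul_assoc, mul_one]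
  match_scalars <;> field_simp <;> ring
end

section
/- Let γ > 0 and σ > 0 be reals, let A be a real N×N matrix, B ∈ ℝ^N a column vector, and X a real symmetric N×N matrix satisfying X A + Aᵀ X − X (B Bᵀ − γσ I) X + (σ/γ) I = 0. Then for all vectors z, e, F ∈ ℝ^N, setting u = −Bᵀ X (z + e) ∈ ℝ, one has 2 zᵀ X (A z + u B + F) + u² − |Bᵀ X e|² + (σ/γ)|z|² − (1/(γσ))|F|² + (1/(γσ))|F − γσ X z|² = 0. -/
open Matrix

theorem dotProduct_mulVec_eq_of_isSymm {n R : Type*} [Fintype n] [CommRing R]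
    {X : Matrix n n R} (hX : X.IsSymm) (x y : n → R) : x ⬝ᵥ X *ᵥ y = X *ᵥ x ⬝ᵥ y := by
  rw [dotProduct_mulVec, ← mulVec_transpose, hX.eq]

/-- The quadratic form of the Riccati operator at `z`, expressed through `X *ᵥ z`. -/
theorem dotProduct_riccati_mulVec {n R : Type*} [Fintype n] [DecidableEq n] [CommRing R]
    (A X : Matrix n n R) (hX : X.IsSymm) (B z : n → R) (a c : R) :
    z ⬝ᵥ (X * A + Aᵀ * X - X * (vecMulVec B B - a • (1 : Matrix n n R)) * X
        + c • (1 : Matrix n n R)) *ᵥ z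
      = 2 * (X *ᵥ z ⬝ᵥ A *ᵥ z) - (B ⬝ᵥ X *ᵥ z) ^ 2 + a * (X *ᵥ z ⬝ᵥ X *ᵥ z)
        + c * (z ⬝ᵥ z) := by
  have htrans (y : n → R) : z ⬝ᵥ Aᵀ *ᵥ y = y ⬝ᵥ A *ᵥ z := by
    rw [dotProduct_mulVec, vecMul_transpose, dotProduct_comm]
  simp only [add_mulVec, sub_mulVec, ← mulVec_mulVec, smul_mulVec, one_mulVec,
    dotProduct_add, dotProduct_sub, dotProduct_smul, vecMulVec_mulVec,
    dotProduct_mulVec_eq_of_isSymm hX z, htrans, op_smul_eq_smul, smul_eq_mul]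
  rw [dotProduct_comm (X *ᵥ z) B]
  ring

/-- Key quadratic-form identity of Theorem 1 (bracket (18a)): if `X` is a
symmetric solution of the Riccati equation, then with `u = −BᵀX(z + e)`,
`2 zᵀX(Az + Bu + F) + u² − |BᵀXe|² + (σ/γ)|z|² − (1/(γσ))|F|²
  + (1/(γσ))|F − γσXz|² = 0`. -/
theorem riccati_state_identity {N : ℕ} (γ σ : ℝ) (hγ : 0 < γ) (hσ : 0 < σ)
    (A X : Matrix (Fin N) (Fin N) ℝ) (hX : X.IsSymm) (B : Fin N → ℝ)
    (hARE : X * A + Aᵀ * X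
        - X * (vecMulVec B B - (γ * σ) • (1 : Matrix (Fin N) (Fin N) ℝ)) * X
        + (σ / γ) • (1 : Matrix (Fin N) (Fin N) ℝ) = 0)
    (z e F : Fin N → ℝ) (u : ℝ) (hu : u = -(B ⬝ᵥ X.mulVec (z + e))) :
    2 * (z ⬝ᵥ X.mulVec (A.mulVec z + u • B + F)) + u ^ 2
        - (B ⬝ᵥ X.mulVec e) ^ 2 + (σ / γ) * (z ⬝ᵥ z) - (1 / (γ * σ)) * (F ⬝ᵥ F)
        + (1 / (γ * σ)) *
          ((F - (γ * σ) • X.mulVec z) ⬝ᵥ (F - (γ * σ) • X.mulVec z)) = 0 := by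
  have h := dotProduct_riccati_mulVec A X hX B z (γ * σ) (σ / γ)
  rw [hARE, zero_mulVec, dotProduct_zero] at h
  have hγσ : 1 / (γ * σ) * (γ * σ) = 1 := one_div_mul_cancel (mul_pos hγ hσ).ne'
  rw [dotProduct_mulVec_eq_of_isSymm hX z, hu]
  simp only [mulVec_add, dotProduct_add, dotProduct_sub, sub_dotProduct, dotProduct_smul,
    smul_dotProduct, smul_eq_mul, dotProduct_comm (X *ᵥ z) B, dotProduct_comm (X *ᵥ z) F]
  linear_combination -h + (γ * σ * (X *ᵥ z ⬝ᵥ X *ᵥ z) - 2 * (F ⬝ᵥ X *ᵥ z)) * hγσ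
end

section
/- Let q > 0 and σ > 0 be reals and N ≥ 1 a natural number with N² > q + σ. Set γ = (2/π) ∑_{n=N}^∞ 1/(n² − q − σ), b_n = (−1)^n √(2/π), and c_n = √(2/π). Then for every real u and all real sequences (z_n)_{n≥N}, (f_n)_{n≥N} such that ∑_{n≥N} n² z_n² and ∑_{n≥N} f_n² converge, one has (2/γ) ∑_{n=N}^∞ z_n(−(n² − q) z_n + b_n u + f_n) + γ^{-2} (2/π) (∑_{n=N}^∞ z_n)² − u² + (σ/γ) ∑_{n=N}^∞ z_n² − (1/(γσ)) ∑_{n=N}^∞ f_n² ≤ 0. -/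
open Real

/-- A sequence with a finite weighted `ℓ²` norm is summable when the reciprocal weights are. -/
theorem summable_of_summable_weight_mul_sq {ι : Type*} {d w : ι → ℝ} (hd : ∀ i, 0 < d i)
    (hS : Summable fun i => 1 / d i) (hD : Summable fun i => d i * w i ^ 2) : Summable w := by
  refine Summable.of_norm_bounded (hS.add hD) fun i => ?_
  have hi := hd i
  have hprod : 1 / d i * (d i * w i ^ 2) = |w i| ^ 2 := by
    rw [sq_abs]; field_simp
  have h₁ : 0 < 1 / d i := by positivity
  have h₂ : 0 ≤ d i * w i ^ 2 := by positivity
  rw [Real.norm_eq_abs]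
  exact abs_le_of_sq_le_sq' (by rw [← hprod]; nlinarith) (by positivity) |>.2

/-- The weighted Cauchy-Schwarz inequality for series. -/
theorem sq_tsum_le_tsum_one_div_mul_tsum {ι : Type*} {d w : ι → ℝ} (hd : ∀ i, 0 < d i)
    (hS : Summable fun i => 1 / d i) (hD : Summable fun i => d i * w i ^ 2) :
    (∑' i, w i) ^ 2 ≤ (∑' i, 1 / d i) * ∑' i, d i * w i ^ 2 := by
  have hw := summable_of_summable_weight_mul_sq hd hS hD
  have hquad : ∀ t : ℝ, 0 ≤ (∑' i, 1 / d i) * (t * t) + (-2 * ∑' i, w i) * t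
      + ∑' i, d i * w i ^ 2 := by
    intro t
    have hsum := ((hS.hasSum.mul_right (t * t)).add
      ((hw.hasSum.mul_left (-2)).mul_right t)).add hD.hasSum
    refine hsum.nonneg fun i => ?_
    have hi := hd i
    have : 1 / d i * (t * t) + -2 * w i * t + d i * w i ^ 2 = (t - d i * w i) ^ 2 / d i := by
      field_simp; ring
    rw [this]; positivity
  have := discrim_le_zero hquad
  rw [discrim] at this
  linarith

/-- The reciprocals of `n² - a`, `n ≥ N`, are summable when `a < N²`. -/
theorem summable_one_div_natCast_add_sq_sub {a : ℝ} {N : ℕ} (ha : 0 ≤ a) (haN : a < (N : ℝ) ^ 2) :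
    Summable fun n : ℕ => 1 / (((n + N : ℕ) : ℝ) ^ 2 - a) := by
  have hN : (0 : ℝ) < (N : ℝ) ^ 2 := ha.trans_lt haN
  have hc : 0 < 1 - a / (N : ℝ) ^ 2 := by rw [sub_pos, div_lt_one hN]; exact haN
  have hsq : Summable fun n : ℕ => 1 / ((n + N : ℕ) : ℝ) ^ 2 :=
    (summable_nat_add_iff N).2 (Real.summable_one_div_nat_pow.2 one_lt_two)
  have hle (n : ℕ) : (N : ℝ) ^ 2 ≤ ((n + N : ℕ) : ℝ) ^ 2 := by gcongr; omega
  refine Summable.of_nonneg_of_le (fun n => ?_) (fun n => ?_)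
    (hsq.mul_left (1 - a / (N : ℝ) ^ 2)⁻¹)
  · have := hle n
    exact one_div_nonneg.2 (by linarith)
  · have hm := hN.trans_le (hle n)
    rw [inv_eq_one_div, one_div_mul_one_div]
    refine one_div_le_one_div_of_le (by positivity) ?_
    have : a ≤ a / (N : ℝ) ^ 2 * ((n + N : ℕ) : ℝ) ^ 2 := by
      rw [div_mul_eq_mul_div, le_div_iff₀ hN]
      exact mul_le_mul_of_nonneg_left (hle n) ha
    linarith

/-- Nonpositivity of the residual bracket (14c): with `λ_n = n²`,
`b_n = (−1)^n √(2/π)`, and the `L²` residue gain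
`γ = (2/π) ∑_{n=N}^∞ 1/(n² − q − σ)`, for every input `u` and all residual
sequences `(z_n)`, `(f_n)` (with `∑ n² z_n²` and `∑ f_n²` convergent),
`(2/γ) ∑_{n≥N} z_n(−(n² − q)z_n + b_n u + f_n) + γ⁻²(2/π)(∑_{n≥N} z_n)²
  − u² + (σ/γ) ∑_{n≥N} z_n² − (1/(γσ)) ∑_{n≥N} f_n² ≤ 0`. -/
theorem residue_bracket_nonpos
    (q σ : ℝ) (hq : 0 < q) (hσ : 0 < σ)
    (N : ℕ) (hN : 1 ≤ N) (hNqσ : q + σ < (N : ℝ) ^ 2)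
    (γ : ℝ) (hγ : γ = (2 / π) * ∑' n : ℕ, 1 / (((n + N : ℕ) : ℝ) ^ 2 - q - σ))
    (b : ℕ → ℝ) (hb : ∀ n, b n = (-1 : ℝ) ^ n * Real.sqrt (2 / π))
    (u : ℝ) (z f : ℕ → ℝ)
    (hzsum : Summable fun n : ℕ => ((n + N : ℕ) : ℝ) ^ 2 * (z (n + N)) ^ 2)
    (hfsum : Summable fun n : ℕ => (f (n + N)) ^ 2) :
    (2 / γ) * (∑' n : ℕ, z (n + N) *
        (-((((n + N : ℕ) : ℝ) ^ 2 - q) * z (n + N)) + b (n + N) * u + f (n + N)))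
      + (γ ^ 2)⁻¹ * (2 / π) * (∑' n : ℕ, z (n + N)) ^ 2
      - u ^ 2
      + (σ / γ) * (∑' n : ℕ, (z (n + N)) ^ 2)
      - (1 / (γ * σ)) * (∑' n : ℕ, (f (n + N)) ^ 2) ≤ 0 := by
  have hle (n : ℕ) : (N : ℝ) ^ 2 ≤ ((n + N : ℕ) : ℝ) ^ 2 := by gcongr; omega
  have hN1 : (1 : ℝ) ≤ (N : ℝ) ^ 2 := one_le_pow₀ (by exact_mod_cast hN)
  set d : ℕ → ℝ := fun n => ((n + N : ℕ) : ℝ) ^ 2 - q - σ with hd_def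
  have hd (n : ℕ) : 0 < d n := by have := hle n; simp only [hd_def]; linarith
  have hS : Summable fun n => 1 / d n := by
    simpa only [hd_def, sub_sub] using
      summable_one_div_natCast_add_sq_sub (add_pos hq hσ).le hNqσ
  have hz2 : Summable fun n : ℕ => z (n + N) ^ 2 :=
    Summable.of_nonneg_of_le (fun n => sq_nonneg _)
      (fun n => le_mul_of_one_le_left (sq_nonneg _) (hN1.trans (hle n))) hzsum
  have hD : Summable fun n => d n * z (n + N) ^ 2 := by
    refine (hzsum.sub (hz2.mul_left (q + σ))).congr fun n => ?_
    simp only [hd_def]; ring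
  have hsign (n : ℕ) : ((-1 : ℝ) ^ (n + N) * z (n + N)) ^ 2 = z (n + N) ^ 2 := by
    rw [mul_pow, ← pow_mul, mul_comm (n + N) 2, pow_mul]; simp
  have hD' : Summable fun n => d n * ((-1 : ℝ) ^ (n + N) * z (n + N)) ^ 2 := by
    simpa only [hsign] using hD
  have hA := summable_of_summable_weight_mul_sq hd hS hD'
  have hZle := sq_tsum_le_tsum_one_div_mul_tsum hd hS hD
  have hAle := sq_tsum_le_tsum_one_div_mul_tsum hd hS hD'
  simp only [hsign] at hAle
  have hzf : Summable fun n : ℕ => z (n + N) * f (n + N) := by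
    refine Summable.of_norm_bounded (hz2.add hfsum) fun n => ?_
    rw [Real.norm_eq_abs, abs_le]
    constructor <;> nlinarith [sq_nonneg (z (n + N) + f (n + N)),
      sq_nonneg (z (n + N) - f (n + N)), sq_nonneg (z (n + N)), sq_nonneg (f (n + N))]
  have hyoung : 2 * ∑' n : ℕ, z (n + N) * f (n + N) ≤
      σ * ∑' n : ℕ, z (n + N) ^ 2 + 1 / σ * ∑' n : ℕ, f (n + N) ^ 2 := by
    refine hasSum_le (fun n => ?_) (hzf.hasSum.mul_left 2)
      ((hz2.hasSum.mul_left σ).add (hfsum.hasSum.mul_left (1 / σ)))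
    have : σ * z (n + N) ^ 2 + 1 / σ * f (n + N) ^ 2 - 2 * (z (n + N) * f (n + N))
        = (σ * z (n + N) - f (n + N)) ^ 2 / σ := by field_simp; ring
    have : 0 ≤ (σ * z (n + N) - f (n + N)) ^ 2 / σ := by positivity
    linarith
  have hmain : ∑' n : ℕ, z (n + N) *
        (-((((n + N : ℕ) : ℝ) ^ 2 - q) * z (n + N)) + b (n + N) * u + f (n + N)) =
      -(∑' n, d n * z (n + N) ^ 2) - σ * (∑' n : ℕ, z (n + N) ^ 2)
        + √(2 / π) * u * (∑' n : ℕ, (-1 : ℝ) ^ (n + N) * z (n + N))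
        + ∑' n : ℕ, z (n + N) * f (n + N) := by
    rw [← (((hD.hasSum.neg.sub (hz2.hasSum.mul_left σ)).add
      (hA.hasSum.mul_left (√(2 / π) * u))).add hzf.hasSum).tsum_eq]
    refine tsum_congr fun n => ?_
    simp only [hd_def, hb]; ring
  have hSpos : 0 < ∑' n, 1 / d n :=
    hS.tsum_pos (fun n => (one_div_pos.2 (hd n)).le) 0 (one_div_pos.2 (hd 0))
  have hs : √(2 / π) ^ 2 = 2 / π := Real.sq_sqrt (by positivity)
  rw [hmain]
  have hspos : 0 < √(2 / π) := by positivity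
  generalize √(2 / π) = s at *
  rw [← hs] at hγ ⊢
  generalize (∑' n, 1 / d n) = S at *
  generalize (∑' n, d n * z (n + N) ^ 2) = D at *
  generalize (∑' n : ℕ, (-1 : ℝ) ^ (n + N) * z (n + N)) = A at *
  generalize (∑' n : ℕ, z (n + N) * f (n + N)) = P at *
  generalize (∑' n : ℕ, z (n + N) ^ 2) = Q at *
  generalize (∑' n : ℕ, f (n + N) ^ 2) = F at *
  generalize (∑' n : ℕ, z (n + N)) = Z at *
  have hγpos : 0 < γ := by rw [hγ]; positivity
  have hid : 2 / γ * (-D - σ * Q + s * u * A + P) + (γ ^ 2)⁻¹ * s ^ 2 * Z ^ 2 - u ^ 2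
      + σ / γ * Q - 1 / (γ * σ) * F =
      -((σ * Q + 1 / σ * F - 2 * P) / γ) - (u - s * A / γ) ^ 2
        - s ^ 2 * ((S * D - A ^ 2) + (S * D - Z ^ 2)) / γ ^ 2
        + 2 * D * (s ^ 2 * S - γ) / γ ^ 2 := by
    field_simp; ring
  have h₁ : 0 ≤ (σ * Q + 1 / σ * F - 2 * P) / γ := div_nonneg (by linarith) hγpos.le
  have h₂ : 0 ≤ s ^ 2 * ((S * D - A ^ 2) + (S * D - Z ^ 2)) / γ ^ 2 :=
    div_nonneg (mul_nonneg (sq_nonneg _) (by linarith)) (sq_nonneg _)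
  have h₃ : 2 * D * (s ^ 2 * S - γ) / γ ^ 2 = 0 := by simp [hγ]
  rw [hid, h₃]
  linarith [sq_nonneg (u - s * A / γ)]
end
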